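/- arXiv:2106.03827 — 10 statements merged into one kernel-verified Lean document; each statement's English description precedes it below -/
import Mathlib

section
/- For any linear assessment policy (θ_1,…,θ_T), the agent's utility satisfies U((θ_t),(e_t)) = Σ_{t=1}^T θ_t ⬝ (W s_0) + Σ_{t=1}^T c_t ⬝ e_t, where c_t = Wᵀθ_t + ΩᵀWᵀ(Σ_{i=t+1}^T θ_i); consequently an effort policy (e_1,…,e_T) maximizes U((θ_t),·) over all effort policies if and only if, for every t ∈ {1,…,T}, e_t maximizes e ↦ c_t ⬝ e over the budget set B. -/
open Matrix Finset

/-- Summation by exchange: pairing each `x t` with the past of `y` is the same as pairing the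
future of `x` with each `y t`. -/
theorem sum_dotProduct_sum_Iio {ι m R : Type*} [Fintype ι] [LinearOrder ι]
    [LocallyFiniteOrderBot ι] [LocallyFiniteOrderTop ι] [Fintype m] [NonUnitalNonAssocSemiring R]
    (x y : ι → m → R) :
    ∑ t, x t ⬝ᵥ ∑ i ∈ Finset.Iio t, y i = ∑ t, (∑ i ∈ Finset.Ioi t, x i) ⬝ᵥ y t := by
  simp_rw [dotProduct_sum, sum_dotProduct]
  exact Finset.sum_comm' fun t i => by simp

/-- A separable objective is maximized over a product of copies of `B` iff each of its terms is
maximized over `B`. -/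
theorem forall_sum_le_sum_iff_forall_le {ι α R : Type*} [Fintype ι] [AddCommGroup R]
    [PartialOrder R] [IsOrderedAddMonoid R] (f : ι → α → R) (B : α → Prop) (e : ι → α)
    (he : ∀ t, B (e t)) :
    (∀ a : ι → α, (∀ t, B (a t)) → ∑ t, f t (a t) ≤ ∑ t, f t (e t)) ↔
      ∀ t b, B b → f t b ≤ f t (e t) := by
  classical
  refine ⟨fun h t b hb => ?_, fun h a ha => Finset.sum_le_sum fun t _ => h t _ (ha t)⟩
  have key := h (Function.update e t b) fun i => by
    by_cases hi : i = t
    · subst hi; simpa using hb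
    · simpa [hi] using he i
  rw [← Finset.add_sum_erase _ _ (Finset.mem_univ t),
    ← Finset.add_sum_erase _ (fun i => f i (e i)) (Finset.mem_univ t),
    Finset.sum_congr rfl (fun i hi => by
      rw [Function.update_of_ne (Finset.ne_of_mem_erase hi)] :
      ∀ i ∈ Finset.univ.erase t, f i (Function.update e t b i) = f i (e i))] at key
  simpa only [Function.update_self, add_le_add_iff_right] using key

/-- For any linear assessment policy `(θ t)` with rules in the simplex, the
agent's utility decomposes as `U θ e = Σ_t θ_t ⬝ (W s0) + Σ_t c_t ⬝ e_t` with
`c_t = Wᵀθ_t + ΩᵀWᵀ (Σ_{i>t} θ_i)`; consequently an effort policy `e` maximizes `U θ ·`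
over all effort policies iff for every `t`, `e t` maximizes `e ↦ c_t ⬝ e` over the budget set. -/
theorem utility_linear_decomposition_and_separability
    (n d T : ℕ) (hn : 0 < n) (hd : 0 < d) (hT : 0 < T)
    (W : Matrix (Fin n) (Fin d) ℝ) (Ω : Matrix (Fin d) (Fin d) ℝ) (s0 : Fin d → ℝ)
    (hW : ∀ k j, 0 ≤ W k j)
    (hΩdiag : ∀ i j, i ≠ j → Ω i j = 0) (hΩ : ∀ i, 0 ≤ Ω i i)
    (θ : Fin T → Fin n → ℝ) (hθ : ∀ t, θ t ∈ stdSimplex ℝ (Fin n))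
    (c : Fin T → Fin d → ℝ)
    (hc : ∀ t, c t = W.transpose.mulVec (θ t) +
      Ω.transpose.mulVec (W.transpose.mulVec (∑ i ∈ Finset.Ioi t, θ i)))
    (e : Fin T → Fin d → ℝ)
    (he : ∀ t, (∀ j, 0 ≤ e t j) ∧ ∑ j, e t j ≤ 1) :
    (∀ a : Fin T → Fin d → ℝ,
      ∑ t, θ t ⬝ᵥ W.mulVec (s0 + Ω.mulVec (∑ i ∈ Finset.Iio t, a i) + a t) =
      (∑ t, θ t ⬝ᵥ W.mulVec s0) + ∑ t, c t ⬝ᵥ a t) ∧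
    ((∀ e' : Fin T → Fin d → ℝ, (∀ t, (∀ j, 0 ≤ e' t j) ∧ ∑ j, e' t j ≤ 1) →
        ∑ t, θ t ⬝ᵥ W.mulVec (s0 + Ω.mulVec (∑ i ∈ Finset.Iio t, e' i) + e' t) ≤
        ∑ t, θ t ⬝ᵥ W.mulVec (s0 + Ω.mulVec (∑ i ∈ Finset.Iio t, e i) + e t)) ↔
      (∀ t, ∀ e' : Fin d → ℝ, (∀ j, 0 ≤ e' j) → ∑ j, e' j ≤ 1 →
        c t ⬝ᵥ e' ≤ c t ⬝ᵥ e t)) := by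
  have decomposition : ∀ a : Fin T → Fin d → ℝ,
      ∑ t, θ t ⬝ᵥ W.mulVec (s0 + Ω.mulVec (∑ i ∈ Finset.Iio t, a i) + a t) =
      (∑ t, θ t ⬝ᵥ W.mulVec s0) + ∑ t, c t ⬝ᵥ a t := by
    intro a
    have exchange := sum_dotProduct_sum_Iio (fun t => Ωᵀ *ᵥ (Wᵀ *ᵥ θ t)) a
    simp_rw [← mulVec_sum] at exchange
    simp_rw [hc, add_dotProduct, mulVec_add, dotProduct_add, Finset.sum_add_distrib, ← exchange]
    simp only [mulVec_transpose, dotProduct_mulVec]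
    ring
  refine ⟨decomposition, ?_⟩
  simp_rw [decomposition, add_le_add_iff_left]
  simpa only [and_imp] using forall_sum_le_sum_iff_forall_le (fun t b => c t ⬝ᵥ b)
    (fun b => (∀ j, 0 ≤ b j) ∧ ∑ j, b j ≤ 1) e he
end

section
/- For every linear assessment policy (θ_1,…,θ_T), there exists a best-response effort policy in which every effort profile is a standard basis vector of ℝ^d: taking e_t to be the standard basis vector at any coordinate maximizing the entries of c_t = Wᵀθ_t + ΩᵀWᵀ(Σ_{i=t+1}^T θ_i) for each t yields a maximizer of the agent's utility U((θ_t),·) over all effort policies. -/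
open Matrix Finset

/-- The total utility is a constant plus the sum over time of the effort's marginal value. -/
theorem sum_dotProduct_mulVec_effort {n d T : ℕ}
    (W : Matrix (Fin n) (Fin d) ℝ) (Ω : Matrix (Fin d) (Fin d) ℝ) (s : Fin d → ℝ)
    (θ : Fin T → Fin n → ℝ) (e : Fin T → Fin d → ℝ) :
    ∑ t, θ t ⬝ᵥ W *ᵥ (s + Ω *ᵥ (∑ i ∈ Finset.Iio t, e i) + e t) =
      ∑ t, θ t ⬝ᵥ W *ᵥ s +
        ∑ t, (Wᵀ *ᵥ θ t + Ωᵀ *ᵥ (Wᵀ *ᵥ ∑ i ∈ Finset.Ioi t, θ i)) ⬝ᵥ e t := by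
  have adj {m k : ℕ} (A : Matrix (Fin m) (Fin k) ℝ) (x : Fin m → ℝ) (y : Fin k → ℝ) :
      (Aᵀ *ᵥ x) ⬝ᵥ y = x ⬝ᵥ A *ᵥ y := by
    rw [mulVec_transpose, dotProduct_mulVec]
  have swap : ∑ t, θ t ⬝ᵥ W *ᵥ (Ω *ᵥ ∑ i ∈ Finset.Iio t, e i) =
      ∑ t, (∑ i ∈ Finset.Ioi t, θ i) ⬝ᵥ W *ᵥ (Ω *ᵥ e t) := by
    simp only [mulVec_sum, dotProduct_sum, sum_dotProduct]
    exact Finset.sum_comm' (by simp)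
  simp only [add_dotProduct, adj, mulVec_add, dotProduct_add, Finset.sum_add_distrib, swap]
  ring

/-- A linear functional bounded above by `M ≥ 0` coordinatewise is at most `M` on the budget set. -/
theorem dotProduct_le_of_budget {ι : Type*} [Fintype ι] {c e : ι → ℝ} {M : ℝ} (hM : 0 ≤ M)
    (hc : ∀ z, c z ≤ M) (he : ∀ z, 0 ≤ e z) (hsum : ∑ z, e z ≤ 1) : c ⬝ᵥ e ≤ M :=
  calc c ⬝ᵥ e ≤ ∑ z, M * e z :=
        Finset.sum_le_sum fun z _ => mul_le_mul_of_nonneg_right (hc z) (he z)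
    _ = M * ∑ z, e z := (Finset.mul_sum _ _ _).symm
    _ ≤ M := mul_le_of_le_one_right hM hsum

theorem mulVec_apply_nonneg {m ι : Type*} [Fintype ι] {A : Matrix m ι ℝ} {x : ι → ℝ}
    (hA : ∀ i j, 0 ≤ A i j) (hx : ∀ j, 0 ≤ x j) (i : m) : 0 ≤ (A *ᵥ x) i :=
  Finset.sum_nonneg fun j _ => mul_nonneg (hA i j) (hx j)

/-- For every linear assessment policy there is a best-response effort policy
consisting of standard basis vectors: if at each time `t` the coordinate `j t` maximizes the
entries of `c t = Wᵀθ_t + ΩᵀWᵀ (Σ_{i>t} θ_i)`, then the effort policy `t ↦ basis vector at j t`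
is a feasible effort policy maximizing the agent's utility over all effort policies. -/
theorem basis_vector_best_response_exists
    (n d T : ℕ) (hn : 0 < n) (hd : 0 < d) (hT : 0 < T)
    (W : Matrix (Fin n) (Fin d) ℝ) (Ω : Matrix (Fin d) (Fin d) ℝ) (s0 : Fin d → ℝ)
    (hW : ∀ k j, 0 ≤ W k j)
    (hΩdiag : ∀ i j, i ≠ j → Ω i j = 0) (hΩ : ∀ i, 0 ≤ Ω i i)
    (θ : Fin T → Fin n → ℝ) (hθ : ∀ t, θ t ∈ stdSimplex ℝ (Fin n))
    (c : Fin T → Fin d → ℝ)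
    (hc : ∀ t, c t = W.transpose.mulVec (θ t) +
      Ω.transpose.mulVec (W.transpose.mulVec (∑ i ∈ Finset.Ioi t, θ i)))
    (j : Fin T → Fin d) (hj : ∀ (t : Fin T) (z : Fin d), c t z ≤ c t (j t)) :
    (∀ t, (∀ z, 0 ≤ (Pi.single (j t) (1 : ℝ) : Fin d → ℝ) z) ∧ ∑ z, (Pi.single (j t) (1 : ℝ) : Fin d → ℝ) z ≤ 1) ∧
    (∀ e' : Fin T → Fin d → ℝ, (∀ t, (∀ z, 0 ≤ e' t z) ∧ ∑ z, e' t z ≤ 1) →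
      ∑ t, θ t ⬝ᵥ W.mulVec (s0 + Ω.mulVec (∑ i ∈ Finset.Iio t, e' i) + e' t) ≤
      ∑ t, θ t ⬝ᵥ W.mulVec
        (s0 + Ω.mulVec (∑ i ∈ Finset.Iio t, (Pi.single (j i) (1 : ℝ) : Fin d → ℝ)) +
          (Pi.single (j t) (1 : ℝ) : Fin d → ℝ))) := by
  have hΩ_nonneg : ∀ a b, 0 ≤ Ω a b := fun a b => by
    by_cases h : a = b
    · exact h ▸ hΩ a
    · exact (hΩdiag a b h).ge
  have hc_nonneg (t : Fin T) (z : Fin d) : 0 ≤ c t z := by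
    rw [hc]
    refine add_nonneg (mulVec_apply_nonneg (fun a b => hW b a) (hθ t).1 z)
      (mulVec_apply_nonneg (fun a b => hΩ_nonneg b a)
        (mulVec_apply_nonneg (fun a b => hW b a) fun k => ?_) z)
    rw [Finset.sum_apply]
    exact Finset.sum_nonneg fun i _ => (hθ i).1 k
  refine ⟨fun t => ⟨fun z => ?_, by simp⟩, fun e' he' => ?_⟩
  · exact (Pi.single_nonneg.2 zero_le_one : (0 : Fin d → ℝ) ≤ Pi.single (j t) 1) z
  · rw [sum_dotProduct_mulVec_effort, sum_dotProduct_mulVec_effort W Ω s0 θ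
      fun t => Pi.single (j t) 1]
    simp only [← hc, dotProduct_single_one]
    gcongr with t
    exact dotProduct_le_of_budget (hc_nonneg t _) (hj t) (he' t).1 (he' t).2
end

section
/- Fix m ∈ {1,…,n} and let θ_s be the m-th standard basis vector of ℝ^n for every s ∈ {1,…,T} (a constant assessment policy). Then for any j ∈ {1,…,d} and any time t' ∈ {1,…,T}, the standard basis vector b_j of ℝ^d maximizes e ↦ c_{t'} ⬝ e over the budget set B, where c_{t'} = Wᵀθ_{t'} + ΩᵀWᵀ(Σ_{i=t'+1}^T θ_i), if and only if (W_{mj} − W_{mz}) + (T − t')·(Ω_{jj} W_{mj} − Ω_{zz} W_{mz}) ≥ 0 for every z ∈ {1,…,d}. -/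
open Matrix Finset

/-- A standard basis vector maximizes a nonnegative linear functional over the budget simplex
exactly when its coefficient is maximal. -/
lemma single_maximizes_dotProduct_iff {ι : Type*} [Fintype ι] [DecidableEq ι]
    (c : ι → ℝ) (j : ι) (hj : 0 ≤ c j) :
    (∀ e : ι → ℝ, (∀ z, 0 ≤ e z) → ∑ z, e z ≤ 1 →
        c ⬝ᵥ e ≤ c ⬝ᵥ (Pi.single j (1 : ℝ) : ι → ℝ)) ↔ ∀ z, c z ≤ c j := by
  simp only [dotProduct_single, mul_one]
  constructor
  · intro h z
    have hz := h (Pi.single z 1) (fun i => by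
      by_cases hi : i = z
      · subst hi; simp
      · simp [hi]) (by simp)
    simpa using hz
  · intro h e he hsum
    calc c ⬝ᵥ e ≤ ∑ z, c j * e z :=
          Finset.sum_le_sum fun z _ => mul_le_mul_of_nonneg_right (h z) (he z)
      _ = c j * ∑ z, e z := (Finset.mul_sum _ _ _).symm
      _ ≤ c j := mul_le_of_le_one_right hj hsum

/-- The transpose of a matrix with vanishing off-diagonal entries acts coordinatewise. -/
lemma transpose_mulVec_apply_of_offDiag_eq_zero {ι : Type*} [Fintype ι]
    (A : Matrix ι ι ℝ) (hA : ∀ i j, i ≠ j → A i j = 0) (v : ι → ℝ) (z : ι) :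
    A.transpose.mulVec v z = A z z * v z := by
  classical
  rw [mulVec, dotProduct, Finset.sum_eq_single z]
  · rfl
  · intro i _ hi
    simp [hA i z hi]
  · simp

/-- Under the constant assessment policy `θ_s = basis vector m`, the basis
vector `b_j` maximizes `e ↦ c_{t'} ⬝ e` over the budget set at time `t'` if and only if
`(W_{mj} − W_{mz}) + (T − t')(Ω_{jj} W_{mj} − Ω_{zz} W_{mz}) ≥ 0` for every `z`. -/
theorem basis_best_response_iff_coefficient_inequality
    (n d T : ℕ) (hn : 0 < n) (hd : 0 < d) (hT0 : 0 < T)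
    (W : Matrix (Fin n) (Fin d) ℝ) (Ω : Matrix (Fin d) (Fin d) ℝ)
    (hW : ∀ k j, 0 ≤ W k j)
    (hΩdiag : ∀ i j, i ≠ j → Ω i j = 0) (hΩ : ∀ i, 0 ≤ Ω i i)
    (m : Fin n) (j : Fin d) (t' : ℕ) (ht1 : 1 ≤ t') (htT : t' ≤ T)
    (θ : ℕ → Fin n → ℝ) (hθ : ∀ s, θ s = (Pi.single m (1 : ℝ) : Fin n → ℝ))
    (c : ℕ → Fin d → ℝ)
    (hc : ∀ s, c s = W.transpose.mulVec (θ s) +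
      Ω.transpose.mulVec (W.transpose.mulVec (∑ i ∈ Finset.Ioc s T, θ i))) :
    (∀ e : Fin d → ℝ, (∀ z, 0 ≤ e z) → ∑ z, e z ≤ 1 →
        c t' ⬝ᵥ e ≤ c t' ⬝ᵥ (Pi.single j (1 : ℝ) : Fin d → ℝ)) ↔
      ∀ z : Fin d,
        (W m j - W m z) + ((T : ℝ) - (t' : ℝ)) * (Ω j j * W m j - Ω z z * W m z) ≥ 0 := by
  have hcoef : ∀ z, c t' z = W m z + Ω z z * (((T : ℝ) - (t' : ℝ)) * W m z) := by
    intro z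
    rw [hc, Pi.add_apply, transpose_mulVec_apply_of_offDiag_eq_zero Ω hΩdiag]
    simp [hθ, mulVec_smul, ← Nat.cast_smul_eq_nsmul ℝ, Nat.cast_sub htT]
  have htT' : (0 : ℝ) ≤ (T : ℝ) - (t' : ℝ) := sub_nonneg.2 (Nat.cast_le.2 htT)
  have hj : 0 ≤ c t' j := by
    rw [hcoef]
    exact add_nonneg (hW m j) (mul_nonneg (hΩ j) (mul_nonneg htT' (hW m j)))
  rw [single_maximizes_dotProduct_iff _ _ hj]
  refine forall_congr' fun z => ?_
  rw [hcoef, hcoef, ge_iff_le, ← sub_nonneg]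
  ring_nf
end

section
/- Under the quadratic-cost model, for any assessment policy (θ_1,…,θ_T) ∈ (Δ^n)^T, the effort policy (e*_1,…,e*_T) defined by e*_t = Wᵀθ_t + ΩᵀWᵀ(Σ_{i=t+1}^T θ_i) has all entries nonnegative and is the unique maximizer of the agent's quadratic-cost utility over all effort policies (e_1,…,e_T) with each e_t ∈ ℝ^d having nonnegative entries. -/
open Matrix Finset

/-- The total assessed reward is affine in the effort policy: the effort at time `t` is paid
directly at time `t` and, through `Ω`, at every later time. -/
theorem sum_dotProduct_mulVec_accumulated_effort
    {m k ι : Type*} [Fintype m] [Fintype k] [Fintype ι] [LinearOrder ι]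
    [LocallyFiniteOrderBot ι] [LocallyFiniteOrderTop ι]
    (W : Matrix m k ℝ) (Ω : Matrix k k ℝ) (s0 : k → ℝ) (θ : ι → m → ℝ) (e : ι → k → ℝ) :
    ∑ t, θ t ⬝ᵥ W.mulVec (s0 + Ω.mulVec (∑ i ∈ Finset.Iio t, e i) + e t) =
      (∑ t, θ t ⬝ᵥ W.mulVec s0) +
        ∑ t, (W.transpose.mulVec (θ t) +
          Ω.transpose.mulVec (W.transpose.mulVec (∑ i ∈ Finset.Ioi t, θ i))) ⬝ᵥ e t := by
  have hswap : ∑ t, θ t ⬝ᵥ W.mulVec (Ω.mulVec (∑ i ∈ Finset.Iio t, e i)) =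
      ∑ t, (∑ i ∈ Finset.Ioi t, θ i) ⬝ᵥ W.mulVec (Ω.mulVec (e t)) := by
    simp only [mulVec_sum, dotProduct_sum, sum_dotProduct]
    exact Finset.sum_comm' (by simp)
  simp only [mulVec_add, dotProduct_add, add_dotProduct, Finset.sum_add_distrib,
    mulVec_transpose, ← dotProduct_mulVec, hswap]
  ring

/-- Completing the square: `x ↦ ∑ a x - (1 / 2) ∑ x ^ 2` is uniquely maximized at `x = a`. -/
theorem sum_dotProduct_sub_half_sum_sq_lt
    {ι k : Type*} [Fintype ι] [Fintype k] {a x : ι → k → ℝ} (h : x ≠ a) :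
    (∑ t, a t ⬝ᵥ x t) - (1 / 2) * ∑ t, ∑ z, (x t z) ^ 2 <
      (∑ t, a t ⬝ᵥ a t) - (1 / 2) * ∑ t, ∑ z, (a t z) ^ 2 := by
  have hpos : 0 < ∑ t, ∑ z, (a t z - x t z) ^ 2 := by
    obtain ⟨t, ht⟩ := Function.ne_iff.mp h
    obtain ⟨z, hz⟩ := Function.ne_iff.mp ht
    refine Finset.sum_pos' (fun _ _ => Finset.sum_nonneg fun _ _ => sq_nonneg _)
      ⟨t, Finset.mem_univ t, Finset.sum_pos' (fun _ _ => sq_nonneg _)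
        ⟨z, Finset.mem_univ z, ?_⟩⟩
    have := sub_ne_zero.mpr hz.symm
    positivity
  have hsq : ∑ t, ∑ z, (a t z - x t z) ^ 2 =
      (∑ t, ∑ z, (a t z) ^ 2) - 2 * (∑ t, a t ⬝ᵥ x t) + ∑ t, ∑ z, (x t z) ^ 2 := by
    simp only [dotProduct, Finset.mul_sum, ← Finset.sum_sub_distrib, ← Finset.sum_add_distrib]
    refine Finset.sum_congr rfl fun t _ => Finset.sum_congr rfl fun z _ => ?_
    ring
  have hself : ∑ t, a t ⬝ᵥ a t = ∑ t, ∑ z, (a t z) ^ 2 := by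
    simp only [dotProduct, sq]
  linarith

/-- A matrix with nonnegative entries maps nonnegative vectors to nonnegative vectors. -/
theorem mulVec_nonneg_of_entries_nonneg {m k : Type*} [Fintype k] {A : Matrix m k ℝ}
    {v : k → ℝ} (hA : ∀ i j, 0 ≤ A i j) (hv : ∀ j, 0 ≤ v j) (i : m) : 0 ≤ A.mulVec v i :=
  Finset.sum_nonneg fun j _ => mul_nonneg (hA i j) (hv j)

/-- Under the quadratic-cost model, for any assessment policy `(θ t)` in the
simplex, the effort policy `e*_t = Wᵀθ_t + ΩᵀWᵀ (Σ_{i>t} θ_i)` has nonnegative entries and is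
the unique maximizer of the agent's quadratic-cost utility over all nonnegative effort
policies. -/
theorem quadratic_cost_best_response
    (n d T : ℕ) (hn : 0 < n) (hd : 0 < d) (hT : 0 < T)
    (W : Matrix (Fin n) (Fin d) ℝ) (Ω : Matrix (Fin d) (Fin d) ℝ) (s0 : Fin d → ℝ)
    (hW : ∀ k j, 0 ≤ W k j)
    (hΩdiag : ∀ i j, i ≠ j → Ω i j = 0) (hΩ : ∀ i, 0 ≤ Ω i i)
    (θ : Fin T → Fin n → ℝ) (hθ : ∀ t, θ t ∈ stdSimplex ℝ (Fin n))
    (estar : Fin T → Fin d → ℝ)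
    (hestar : ∀ t, estar t = W.transpose.mulVec (θ t) +
      Ω.transpose.mulVec (W.transpose.mulVec (∑ i ∈ Finset.Ioi t, θ i))) :
    (∀ t z, 0 ≤ estar t z) ∧
    ∀ e : Fin T → Fin d → ℝ, (∀ t z, 0 ≤ e t z) → e ≠ estar →
      (∑ t, θ t ⬝ᵥ W.mulVec (s0 + Ω.mulVec (∑ i ∈ Finset.Iio t, e i) + e t)) -
        (1 / 2) * ∑ t, ∑ z, (e t z) ^ 2 <
      (∑ t, θ t ⬝ᵥ W.mulVec (s0 + Ω.mulVec (∑ i ∈ Finset.Iio t, estar i) + estar t)) -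
        (1 / 2) * ∑ t, ∑ z, (estar t z) ^ 2 := by
  refine ⟨fun t z => ?_, fun e _ hne => ?_⟩
  · have hΩ' : ∀ i j, 0 ≤ Ω i j := fun i j => by
      rcases eq_or_ne i j with rfl | hij
      · exact hΩ i
      · exact (hΩdiag i j hij).ge
    rw [hestar]
    refine add_nonneg (mulVec_nonneg_of_entries_nonneg (fun i j => hW j i) (hθ t).1 z)
      (mulVec_nonneg_of_entries_nonneg (fun i j => hΩ' j i)
        (mulVec_nonneg_of_entries_nonneg (fun i j => hW j i) fun k => ?_) z)
    rw [Finset.sum_apply]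
    exact Finset.sum_nonneg fun i _ => (hθ i).1 k
  · simp only [sum_dotProduct_mulVec_accumulated_effort, ← hestar]
    linarith [sum_dotProduct_sub_half_sum_sq_lt hne]
end

section
/- Let Λ be a d×d diagonal matrix with nonnegative diagonal entries and let (θ_1,…,θ_T) ∈ (Δ^n)^T. With e*_t = Wᵀθ_t + ΩᵀWᵀ(Σ_{i=t+1}^T θ_i), one has the identity ‖Λ Σ_{t=1}^T e*_t‖₁ = Σ_{t=1}^T 1_dᵀ Λ (I + (t−1) Ωᵀ) Wᵀ θ_t, where 1_d is the all-ones vector in ℝ^d and ‖·‖₁ is the ℓ¹ norm. -/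
open Matrix Finset

theorem Matrix.mulVec_apply_nonneg_of_nonneg {m n : Type*} [Fintype n] {A : Matrix m n ℝ}
    {v : n → ℝ} (hA : ∀ i j, 0 ≤ A i j) (hv : ∀ j, 0 ≤ v j) (i : m) : 0 ≤ (A *ᵥ v) i :=
  Finset.sum_nonneg fun j _ => mul_nonneg (hA i j) (hv j)

theorem Matrix.apply_nonneg_of_diagonal {m : Type*} {A : Matrix m m ℝ}
    (hdiag : ∀ i j, i ≠ j → A i j = 0) (hA : ∀ i, 0 ≤ A i i) (i j : m) : 0 ≤ A i j := by
  rcases eq_or_ne i j with rfl | h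
  · exact hA i
  · exact (hdiag i j h).ge

theorem Fin.sum_sum_Ioi {T : ℕ} {M : Type*} [AddCommMonoid M] (f : Fin T → M) :
    ∑ t, ∑ i ∈ Finset.Ioi t, f i = ∑ i : Fin T, i.val • f i := by
  rw [Finset.sum_comm' (t' := Finset.univ) (s' := fun i => Finset.Iio i) (by simp)]
  simp

/-- For a diagonal nonnegative `Λ` and an assessment policy `(θ t)` in the
simplex, with quadratic-cost best responses `e*_t = Wᵀθ_t + ΩᵀWᵀ (Σ_{i>t} θ_i)`, one has
`‖Λ Σ_t e*_t‖₁ = Σ_t 1ᵀ Λ (I + (t−1) Ωᵀ) Wᵀ θ_t` (here time `t` runs over `Fin T`, so `t.val`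
plays the role of `t − 1` for `t ∈ {1, …, T}`). -/
theorem principal_objective_identity
    (n d T : ℕ) (hn : 0 < n) (hd : 0 < d) (hT : 0 < T)
    (W : Matrix (Fin n) (Fin d) ℝ) (Ω : Matrix (Fin d) (Fin d) ℝ)
    (Λ : Matrix (Fin d) (Fin d) ℝ)
    (hW : ∀ k j, 0 ≤ W k j)
    (hΩdiag : ∀ i j, i ≠ j → Ω i j = 0) (hΩ : ∀ i, 0 ≤ Ω i i)
    (hΛdiag : ∀ i j, i ≠ j → Λ i j = 0) (hΛ : ∀ i, 0 ≤ Λ i i)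
    (θ : Fin T → Fin n → ℝ) (hθ : ∀ t, θ t ∈ stdSimplex ℝ (Fin n))
    (estar : Fin T → Fin d → ℝ)
    (hestar : ∀ t, estar t = W.transpose.mulVec (θ t) +
      Ω.transpose.mulVec (W.transpose.mulVec (∑ i ∈ Finset.Ioi t, θ i))) :
    ∑ z, |Λ.mulVec (∑ t, estar t) z| =
      ∑ t : Fin T, (fun _ : Fin d => (1 : ℝ)) ⬝ᵥ
        ((Λ * ((1 : Matrix (Fin d) (Fin d) ℝ) + (t.val : ℝ) • Ω.transpose) *
          W.transpose).mulVec (θ t)) := by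
  have hΩ' := Matrix.apply_nonneg_of_diagonal hΩdiag hΩ
  have hΛ' := Matrix.apply_nonneg_of_diagonal hΛdiag hΛ
  have hWθ (u : Fin n → ℝ) (hu : ∀ k, 0 ≤ u k) (j : Fin d) : 0 ≤ (Wᵀ *ᵥ u) j :=
    Matrix.mulVec_apply_nonneg_of_nonneg (fun j k => hW k j) hu j
  have hestar_nonneg (t : Fin T) (j : Fin d) : 0 ≤ estar t j := by
    rw [hestar]
    refine add_nonneg (hWθ _ (hθ t).1 j) ?_
    refine Matrix.mulVec_apply_nonneg_of_nonneg (fun i k => hΩ' k i) (hWθ _ fun k => ?_) j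
    rw [Finset.sum_apply]
    exact Finset.sum_nonneg fun i _ => (hθ i).1 k
  have hΛe (z : Fin d) : 0 ≤ (Λ *ᵥ ∑ t, estar t) z := by
    refine Matrix.mulVec_apply_nonneg_of_nonneg hΛ' (fun j => ?_) z
    rw [Finset.sum_apply]
    exact Finset.sum_nonneg fun t _ => hestar_nonneg t j
  have hsum : ∑ t, estar t =
      ∑ t : Fin T, (((1 : Matrix (Fin d) (Fin d) ℝ) + (t.val : ℝ) • Ωᵀ) * Wᵀ) *ᵥ θ t := by
    simp_rw [hestar, Finset.sum_add_distrib, ← Matrix.mulVec_sum, Fin.sum_sum_Ioi,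
      Matrix.mulVec_sum, ← Finset.sum_add_distrib]
    refine Finset.sum_congr rfl fun t _ => ?_
    rw [← Nat.cast_smul_eq_nsmul ℝ, Matrix.add_mul, Matrix.one_mul, Matrix.add_mulVec, Matrix.smul_mul,
      Matrix.smul_mulVec, Matrix.mulVec_smul, Matrix.mulVec_smul, Matrix.mulVec_mulVec]
  simp_rw [abs_of_nonneg (hΛe _), hsum, Matrix.mulVec_sum, Matrix.mulVec_mulVec,
    Finset.sum_apply, ← Matrix.mul_assoc]
  rw [Finset.sum_comm]
  simp [dotProduct]
end

section
/- Let Λ be a d×d diagonal matrix with nonnegative diagonal entries. For each t ∈ {1,…,T} let v_t ∈ ℝ^n be the vector with entries (v_t)_k = Σ_{j=1}^d Λ_{jj}(1 + (t−1)Ω_{jj}) W_{kj}, and let m_t be any index maximizing the entries of v_t. Then the assessment policy θ*_t = the m_t-th standard basis vector of ℝ^n maximizes, over all assessment policies (θ_1,…,θ_T) ∈ (Δ^n)^T, the principal's objective ‖Λ Σ_{t=1}^T e*_t(θ_1,…,θ_T)‖₁, where e*_t(θ) = Wᵀθ_t + ΩᵀWᵀ(Σ_{i=t+1}^T θ_i)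 is the agent's quadratic-cost best response. -/
open Matrix Finset

theorem sum_sum_Ioi_eq_sum_val_mul {T : ℕ} (f : Fin T → ℝ) :
    ∑ t, ∑ i ∈ Finset.Ioi t, f i = ∑ i, (i.val : ℝ) * f i := by
  rw [Finset.sum_comm' (t' := Finset.univ) (s' := fun i => Finset.Iio i) (by simp)]
  simp

theorem mulVec_eq_of_offDiag_eq_zero {d : ℕ} {D : Matrix (Fin d) (Fin d) ℝ}
    (hD : ∀ i j, i ≠ j → D i j = 0) (x : Fin d → ℝ) (z : Fin d) :
    D.mulVec x z = D z z * x z := by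
  rw [Matrix.mulVec, dotProduct, Finset.sum_eq_single z]
  · intro j _ hj
    rw [hD z j hj.symm, zero_mul]
  · simp

/-- Each assessment vector `θ t` contributes linearly to the cumulative effort. -/
theorem mulVec_sum_bestResponse_apply {n d T : ℕ}
    (W : Matrix (Fin n) (Fin d) ℝ) {Ω Λ : Matrix (Fin d) (Fin d) ℝ}
    (hΩdiag : ∀ i j, i ≠ j → Ω i j = 0) (hΛdiag : ∀ i j, i ≠ j → Λ i j = 0)
    (θ : Fin T → Fin n → ℝ) (z : Fin d) :
    Λ.mulVec (∑ t, (W.transpose.mulVec (θ t) +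
      Ω.transpose.mulVec (W.transpose.mulVec (∑ i ∈ Finset.Ioi t, θ i)))) z =
    ∑ t, ∑ k, θ t k * (Λ z z * (1 + (t.val : ℝ) * Ω z z) * W k z) := by
  have hΩt : ∀ i j, i ≠ j → Ω.transpose i j = 0 := fun i j h => hΩdiag j i h.symm
  rw [mulVec_eq_of_offDiag_eq_zero hΛdiag]
  simp only [Finset.sum_apply, Pi.add_apply, mulVec_eq_of_offDiag_eq_zero hΩt,
    Matrix.mulVec_sum, Matrix.transpose_apply]
  rw [Finset.sum_add_distrib, sum_sum_Ioi_eq_sum_val_mul, ← Finset.sum_add_distrib,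
    Finset.mul_sum]
  refine Finset.sum_congr rfl fun t _ => ?_
  simp only [Matrix.mulVec, dotProduct, Matrix.transpose_apply, Finset.mul_sum,
    ← Finset.sum_add_distrib]
  exact Finset.sum_congr rfl fun k _ => by ring

/-- For a nonnegative policy the principal's objective is linear, with coefficients `v t k`. -/
theorem sum_abs_mulVec_sum_bestResponse {n d T : ℕ}
    {W : Matrix (Fin n) (Fin d) ℝ} {Ω Λ : Matrix (Fin d) (Fin d) ℝ}
    (hW : ∀ k j, 0 ≤ W k j)
    (hΩdiag : ∀ i j, i ≠ j → Ω i j = 0) (hΩ : ∀ i, 0 ≤ Ω i i)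
    (hΛdiag : ∀ i j, i ≠ j → Λ i j = 0) (hΛ : ∀ i, 0 ≤ Λ i i)
    {θ : Fin T → Fin n → ℝ} (hθ : ∀ t k, 0 ≤ θ t k) :
    ∑ z, |Λ.mulVec (∑ t, (W.transpose.mulVec (θ t) +
      Ω.transpose.mulVec (W.transpose.mulVec (∑ i ∈ Finset.Ioi t, θ i)))) z| =
    ∑ t, ∑ k, θ t k * ∑ j, Λ j j * (1 + (t.val : ℝ) * Ω j j) * W k j := by
  simp only [mulVec_sum_bestResponse_apply W hΩdiag hΛdiag]
  have habs (z : Fin d) :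
      |∑ t, ∑ k, θ t k * (Λ z z * (1 + (t.val : ℝ) * Ω z z) * W k z)| =
        ∑ t, ∑ k, θ t k * (Λ z z * (1 + (t.val : ℝ) * Ω z z) * W k z) := by
    refine abs_of_nonneg (Finset.sum_nonneg fun t _ => Finset.sum_nonneg fun k _ => ?_)
    have := hθ t k
    have := hΛ z
    have := hΩ z
    have := hW k z
    positivity
  simp only [habs, Finset.mul_sum]
  rw [Finset.sum_comm]
  exact Finset.sum_congr rfl fun t _ => Finset.sum_comm

/-- For each time `t` let `v_t ∈ ℝ^n` have entries
`(v_t)_k = Σ_j Λ_{jj} (1 + (t−1) Ω_{jj}) W_{kj}` and let `m t` maximize the entries of `v_t`.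
Then the assessment policy `θ*_t = basis vector at m t` maximizes the principal's objective
`‖Λ Σ_t e*_t(θ)‖₁` over all assessment policies `(θ t)` in the simplex, where
`e*_t(θ) = Wᵀθ_t + ΩᵀWᵀ (Σ_{i>t} θ_i)` is the agent's quadratic-cost best response (time is
indexed by `Fin T`, so `t.val` plays the role of `t − 1`). -/
theorem principal_optimal_policy_quadratic_cost
    (n d T : ℕ) (hn : 0 < n) (hd : 0 < d) (hT : 0 < T)
    (W : Matrix (Fin n) (Fin d) ℝ) (Ω : Matrix (Fin d) (Fin d) ℝ)
    (Λ : Matrix (Fin d) (Fin d) ℝ)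
    (hW : ∀ k j, 0 ≤ W k j)
    (hΩdiag : ∀ i j, i ≠ j → Ω i j = 0) (hΩ : ∀ i, 0 ≤ Ω i i)
    (hΛdiag : ∀ i j, i ≠ j → Λ i j = 0) (hΛ : ∀ i, 0 ≤ Λ i i)
    (v : Fin T → Fin n → ℝ)
    (hv : ∀ t k, v t k = ∑ j, Λ j j * (1 + (t.val : ℝ) * Ω j j) * W k j)
    (m : Fin T → Fin n) (hm : ∀ (t : Fin T) (k : Fin n), v t k ≤ v t (m t)) :
    (∀ t, (Pi.single (m t) (1 : ℝ) : Fin n → ℝ) ∈ stdSimplex ℝ (Fin n)) ∧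
    ∀ θ : Fin T → Fin n → ℝ, (∀ t, θ t ∈ stdSimplex ℝ (Fin n)) →
      ∑ z, |Λ.mulVec (∑ t, (W.transpose.mulVec (θ t) +
        Ω.transpose.mulVec (W.transpose.mulVec (∑ i ∈ Finset.Ioi t, θ i)))) z| ≤
      ∑ z, |Λ.mulVec (∑ t, (W.transpose.mulVec (Pi.single (m t) (1 : ℝ)) +
        Ω.transpose.mulVec (W.transpose.mulVec
          (∑ i ∈ Finset.Ioi t, (Pi.single (m i) (1 : ℝ) : Fin n → ℝ))))) z| := by
  have hsingle (t : Fin T) : (Pi.single (m t) (1 : ℝ) : Fin n → ℝ) ∈ stdSimplex ℝ (Fin n) :=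
    single_mem_stdSimplex ℝ (m t)
  refine ⟨hsingle, fun θ hθ => ?_⟩
  rw [sum_abs_mulVec_sum_bestResponse hW hΩdiag hΩ hΛdiag hΛ fun t k => (hθ t).1 k,
    sum_abs_mulVec_sum_bestResponse (θ := fun t => Pi.single (m t) 1) hW hΩdiag hΩ hΛdiag hΛ
      fun t k => (hsingle t).1 k]
  simp only [← hv]
  refine Finset.sum_le_sum fun t _ => ?_
  calc ∑ k, θ t k * v t k ≤ ∑ k, θ t k * v t (m t) :=
        Finset.sum_le_sum fun k _ => mul_le_mul_of_nonneg_left (hm t k) ((hθ t).1 k)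
    _ = v t (m t) := by rw [← Finset.sum_mul, (hθ t).2, one_mul]
    _ = ∑ k, (Pi.single (m t) (1 : ℝ) : Fin n → ℝ) k * v t k := by simp [Pi.single_apply]
end

section
/- For every positive integer n and every k ∈ {1,…,n}, there exists a positive integer t such that for all z ∈ {1,…,n} with z ≠ k: (k/(k+1)²)·(1 + (t−1)·k/(100n³)) > (z/(z+1)²)·(1 + (t−1)·z/(100n³)). -/
/-- Up to a positive denominator, the difference of the coefficients of `k` and `z` at slope `a`
factors through `z - k`. -/
lemma coefficient_sub_coefficient (a : ℝ) {k z : ℝ} (hk : k + 1 ≠ 0) (hz : z + 1 ≠ 0) :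
    k / (k + 1) ^ 2 * (1 + a * k) - z / (z + 1) ^ 2 * (1 + a * z) =
      (z - k) * (k * z * (1 - 2 * a) - 1 - a * (k + z)) / ((k + 1) ^ 2 * (z + 1) ^ 2) := by
  field_simp
  ring

/-- The slope `(k - 1) / (2k)` makes `k` the maximizer; a small perturbation `e` keeps it the strict
maximizer among points at distance at least one. -/
lemma coefficient_lt_coefficient {k z e : ℝ} (hk : 0 < k) (hz : 0 < z) (hkz : 1 ≤ |z - k|)
    (he : 0 ≤ e) (hs : e * (2 * k * z + k + z) < 1 / 2) :
    z / (z + 1) ^ 2 * (1 + ((k - 1) / (2 * k) - e) * z) <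
      k / (k + 1) ^ 2 * (1 + ((k - 1) / (2 * k) - e) * k) := by
  rw [← sub_pos, coefficient_sub_coefficient _ (by positivity) (by positivity)]
  refine div_pos ?_ (by positivity)
  have hfactor : (z - k) * (k * z * (1 - 2 * ((k - 1) / (2 * k) - e)) - 1
      - ((k - 1) / (2 * k) - e) * (k + z)) =
      (z - k) ^ 2 / 2 + (z - k) ^ 2 / (2 * k) + (z - k) * (e * (2 * k * z + k + z)) := by
    field_simp
    ring
  rw [hfactor]
  have hquot : 0 ≤ (z - k) ^ 2 / (2 * k) := by positivity
  have hnonneg : 0 ≤ e * (2 * k * z + k + z) := by positivity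
  rcases le_abs.mp hkz with h | h <;> nlinarith

/-- For every positive integer `n` and every `k ∈ {1, …, n}` there is a
positive integer `t` such that for all `z ∈ {1, …, n}` with `z ≠ k`,
`(k/(k+1)²)(1 + (t−1)k/(100n³)) > (z/(z+1)²)(1 + (t−1)z/(100n³))`. -/
theorem each_coefficient_eventually_strictly_maximal
    (n : ℕ) (hn : 0 < n) (k : ℕ) (hk1 : 1 ≤ k) (hkn : k ≤ n) :
    ∃ t : ℕ, 0 < t ∧ ∀ z : ℕ, 1 ≤ z → z ≤ n → z ≠ k →
      ((k : ℝ) / ((k : ℝ) + 1) ^ 2) * (1 + ((t : ℝ) - 1) * (k : ℝ) / (100 * (n : ℝ) ^ 3)) >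
      ((z : ℝ) / ((z : ℝ) + 1) ^ 2) * (1 + ((t : ℝ) - 1) * (z : ℝ) / (100 * (n : ℝ) ^ 3)) := by
  have hk : (1 : ℝ) ≤ k := by exact_mod_cast hk1
  have hn1 : (1 : ℝ) ≤ n := by exact_mod_cast hn
  have hkn' : (k : ℝ) ≤ n := by exact_mod_cast hkn
  set N : ℝ := 100 * (n : ℝ) ^ 3 with hN
  have hNpos : 0 < N := by positivity
  set x : ℝ := N * (((k : ℝ) - 1) / (2 * k)) with hx
  have hx0 : 0 ≤ x := mul_nonneg hNpos.le (div_nonneg (by linarith) (by linarith))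
  refine ⟨⌊x⌋₊ + 1, Nat.succ_pos _, fun z hz1 hzn hzk => ?_⟩
  have hz : (1 : ℝ) ≤ z := by exact_mod_cast hz1
  have hzn' : (z : ℝ) ≤ n := by exact_mod_cast hzn
  set e : ℝ := (x - ⌊x⌋₊) / N with he
  have he0 : 0 ≤ e := div_nonneg (sub_nonneg.mpr (Nat.floor_le hx0)) hNpos.le
  have heN : e ≤ 1 / N := by
    rw [he]
    gcongr
    linarith [Nat.lt_floor_add_one x]
  have hslope (y : ℝ) : (((⌊x⌋₊ + 1 : ℕ) : ℝ) - 1) * y / N = (((k : ℝ) - 1) / (2 * k) - e) * y := by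
    have hfloor : ((k : ℝ) - 1) / (2 * k) - e = ⌊x⌋₊ / N := by
      have hxN : x / N = ((k : ℝ) - 1) / (2 * k) := mul_div_cancel_left₀ _ hNpos.ne'
      rw [he, ← hxN]
      ring
    rw [hfloor]
    push_cast
    ring
  rw [gt_iff_lt, hslope, hslope]
  refine coefficient_lt_coefficient (by linarith) (by linarith) ?_ he0 ?_
  · have : (1 : ℤ) ≤ |(z : ℤ) - k| := Int.one_le_abs (by omega)
    exact_mod_cast this
  · have hbound : 2 * (k : ℝ) * z + k + z ≤ 4 * (n : ℝ) ^ 3 := by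
      have hkz : (k : ℝ) * z ≤ n * n := by gcongr
      have hcube : (n : ℝ) ^ 2 ≤ (n : ℝ) ^ 3 := pow_le_pow_right₀ hn1 (by norm_num)
      nlinarith
    calc e * (2 * k * z + k + z) ≤ 1 / N * (4 * (n : ℝ) ^ 3) := by gcongr
      _ = 1 / 25 := by
        rw [hN]
        field_simp
        norm_num
      _ < 1 / 2 := by norm_num
end

section
/- Let j ∈ {1,…,d}, let m ∈ {1,…,n} be an index with W_{mj} = max_{k} W_{kj}, and suppose Ω_{jj} > 0, W_{mj} > 0, and E > 0. If T is the least integer with T ≥ 1/2 − 1/Ω_{jj} + (1/2)·√((2/Ω_{jj} − 1)² + 8E/(Ω_{jj} W_{mj})), then Σ_{t=1}^T (1 + Ω_{jj}(T − t))·W_{mj} ≥ E; consequently, under the constant assessment policy θ_t = the m-th standard basis vector of ℝ^n for all t, the agent's quadratic-cost best-response efforts e*_t = Wᵀθ_t + ΩᵀWᵀ(Σ_{i=t+1}^T θ_i) satisfy Σ_{t=1}^T (e*_t)_j ≥ E, so effort component j is (T,E)-incentivizable. -/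
open Matrix Finset

/-- A closed form for the sum of an arithmetic progression over `Icc 1 N`. -/
theorem sum_Icc_one_add_mul_sub (a c w : ℝ) (N : ℕ) :
    ∑ t ∈ Finset.Icc 1 N, (1 + a * (c - (t : ℝ))) * w =
      (N + a * (c * N - N * (N + 1) / 2)) * w := by
  induction N with
  | zero => simp
  | succ N ih =>
    rw [Finset.sum_Icc_succ_top (by omega), ih]
    push_cast
    ring

/-- A number at least the larger root of the quadratic makes it nonnegative. -/
theorem le_of_larger_root_le {a w E x : ℝ} (ha : 0 < a) (hw : 0 < w)
    (hx : 1 / 2 - 1 / a + 1 / 2 * Real.sqrt ((2 / a - 1) ^ 2 + 8 * E / (a * w)) ≤ x) :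
    E ≤ (x + a * (x * x - x * (x + 1) / 2)) * w := by
  have hsqrt : Real.sqrt ((2 / a - 1) ^ 2 + 8 * E / (a * w)) ≤ 2 * x + (2 / a - 1) := by
    have h : 2 / a = 2 * (1 / a) := by ring
    linarith
  have hsq := (Real.sqrt_le_iff.mp hsqrt).2
  have hdiv : 8 * E / (a * w) ≤ 4 * x ^ 2 + 4 * x * (2 / a - 1) := by linarith
  rw [div_le_iff₀ (mul_pos ha hw)] at hdiv
  have hexp : (4 * x ^ 2 + 4 * x * (2 / a - 1)) * (a * w) =
      8 * ((x + a * (x * x - x * (x + 1) / 2)) * w) := by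
    field_simp
    ring
  linarith

/-- Under a constant basis-vector policy, coordinate `j` of the best response in round `t`. -/
theorem constant_policy_effort {n d : ℕ}
    (W : Matrix (Fin n) (Fin d) ℝ) (Ω : Matrix (Fin d) (Fin d) ℝ)
    (hΩdiag : ∀ i j, i ≠ j → Ω i j = 0) (j : Fin d) (m : Fin n) {t T : ℕ} (ht : t ≤ T) :
    (W.transpose.mulVec (Pi.single m (1 : ℝ)) + Ω.transpose.mulVec
      (W.transpose.mulVec (∑ _i ∈ Finset.Ioc t T, Pi.single m (1 : ℝ)))) j =
      (1 + Ω j j * ((T : ℝ) - (t : ℝ))) * W m j := by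
  have hΩ : ∀ v : Fin d → ℝ, Ω.transpose.mulVec v j = Ω j j * v j := by
    intro v
    simp only [Matrix.mulVec, dotProduct, Matrix.transpose_apply]
    exact Finset.sum_eq_single j (fun i _ hij => by simp [hΩdiag i j hij]) (by simp)
  rw [Pi.add_apply, hΩ, Finset.sum_const, Nat.card_Ioc, Matrix.mulVec_smul, Pi.smul_apply,
    Matrix.mulVec_single_one, nsmul_eq_mul, Nat.cast_sub ht]
  simp only [Matrix.col_apply, Matrix.transpose_apply]
  ring

/-- Let `m` attain the maximum of column `j` of `W`, with `Ω_{jj} > 0`,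
`W_{mj} > 0`, `E > 0`.  If `T` is the least integer with
`T ≥ 1/2 − 1/Ω_{jj} + (1/2)√((2/Ω_{jj} − 1)² + 8E/(Ω_{jj} W_{mj}))`, then
`Σ_{t=1}^T (1 + Ω_{jj}(T − t)) W_{mj} ≥ E`; consequently under the constant assessment
policy `θ_t = basis vector m`, the quadratic-cost best responses
`e*_t = Wᵀθ_t + ΩᵀWᵀ(Σ_{i=t+1}^T θ_i)` satisfy `Σ_{t=1}^T (e*_t)_j ≥ E`, so effort
component `j` is `(T, E)`-incentivizable. -/
theorem TE_incentivizable
    (n d : ℕ) (hn : 0 < n) (hd : 0 < d)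
    (W : Matrix (Fin n) (Fin d) ℝ) (Ω : Matrix (Fin d) (Fin d) ℝ)
    (hW : ∀ k j, 0 ≤ W k j)
    (hΩdiag : ∀ i j, i ≠ j → Ω i j = 0) (hΩ : ∀ i, 0 ≤ Ω i i)
    (j : Fin d) (m : Fin n) (hmax : ∀ k, W k j ≤ W m j)
    (hΩpos : 0 < Ω j j) (hWpos : 0 < W m j) (E : ℝ) (hE : 0 < E)
    (T : ℕ)
    (hT : 1 / 2 - 1 / Ω j j +
      1 / 2 * Real.sqrt ((2 / Ω j j - 1) ^ 2 + 8 * E / (Ω j j * W m j)) ≤ (T : ℝ))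
    (hTleast : ∀ T' : ℕ,
      1 / 2 - 1 / Ω j j +
        1 / 2 * Real.sqrt ((2 / Ω j j - 1) ^ 2 + 8 * E / (Ω j j * W m j)) ≤ (T' : ℝ) →
      T ≤ T')
    (θ : ℕ → Fin n → ℝ) (hθ : ∀ t, θ t = (Pi.single m (1 : ℝ) : Fin n → ℝ))
    (estar : ℕ → Fin d → ℝ)
    (hestar : ∀ t, estar t = W.transpose.mulVec (θ t) +
      Ω.transpose.mulVec (W.transpose.mulVec (∑ i ∈ Finset.Ioc t T, θ i))) :
    E ≤ ∑ t ∈ Finset.Icc 1 T, (1 + Ω j j * ((T : ℝ) - (t : ℝ))) * W m j ∧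
    E ≤ ∑ t ∈ Finset.Icc 1 T, estar t j := by
  have hsum : E ≤ ∑ t ∈ Finset.Icc 1 T, (1 + Ω j j * ((T : ℝ) - (t : ℝ))) * W m j := by
    rw [sum_Icc_one_add_mul_sub]
    exact le_of_larger_root_le hΩpos hWpos hT
  refine ⟨hsum, hsum.trans_eq (Finset.sum_congr rfl fun t ht => ?_)⟩
  simp only [hestar, hθ]
  exact (constant_policy_effort W Ω hΩdiag j m (Finset.mem_Icc.mp ht).2).symm
end

section
/- Let I be a finite nonempty index set and for each k ∈ I let f_k : ℝ → ℝ be an affine function, f_k(t) = a_k + b_k·t. Suppose t₁ < t₂ < t₃ are real numbers, f_k(t₁) = max_{j ∈ I} f_j(t₁), and f_k(t₂) < max_{j ∈ I} f_j(t₂). Then f_k(t₃) < max_{j ∈ I} f_j(t₃). -/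
open Finset

/-- Among finitely many affine functions of time, once a function that was
maximal at some earlier time fails to be maximal, it is never maximal again: if
`f k t₁ = max_j f j t₁` and `f k t₂ < max_j f j t₂` with `t₁ < t₂ < t₃`, then
`f k t₃ < max_j f j t₃`. -/
theorem affine_max_never_returns
    (I : Type*) [Fintype I] [Nonempty I]
    (a b : I → ℝ) (f : I → ℝ → ℝ) (hf : ∀ k t, f k t = a k + b k * t)
    (k : I) (t₁ t₂ t₃ : ℝ) (h12 : t₁ < t₂) (h23 : t₂ < t₃)
    (h1 : f k t₁ = Finset.univ.sup' Finset.univ_nonempty (fun j => f j t₁))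
    (h2 : f k t₂ < Finset.univ.sup' Finset.univ_nonempty (fun j => f j t₂)) :
    f k t₃ < Finset.univ.sup' Finset.univ_nonempty (fun j => f j t₃) := by
  obtain ⟨j, -, hj⟩ := (Finset.lt_sup'_iff _).1 h2
  have hj₁ : f j t₁ ≤ f k t₁ :=
    h1 ▸ Finset.le_sup' (fun j => f j t₁) (Finset.mem_univ j)
  refine (Finset.lt_sup'_iff _).2 ⟨j, Finset.mem_univ j, ?_⟩
  simp only [hf] at hj hj₁ ⊢
  have hslope : b k < b j := by
    by_contra! h
    nlinarith [mul_le_mul_of_nonneg_right h (sub_nonneg.2 h12.le)]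
  nlinarith [mul_lt_mul_of_pos_right hslope (sub_pos.2 h23)]
end

section
/- For every positive integer n there exist n×n diagonal matrices W, Ω, Λ with strictly positive diagonal entries and a positive integer T such that for every k ∈ {1,…,n} there is a round t ∈ {1,…,T} at which the k-th standard basis vector of ℝ^n is the unique maximizer over the standard probability simplex Δ^n of θ ↦ 1_nᵀ Λ (I + (t−1) Ωᵀ) Wᵀ θ; hence the principal's optimal assessment policy can contain n distinct assessment rules. -/
open Matrix Finset

/-- A linear functional on the standard simplex whose coefficient vector has a strict maximum at
`k` is uniquely maximized at the `k`-th vertex. -/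
theorem sum_mul_lt_of_mem_stdSimplex_of_ne_single {ι : Type*} [Fintype ι] [DecidableEq ι]
    {c θ : ι → ℝ} {k : ι} (hc : ∀ i, i ≠ k → c i < c k) (hθ : θ ∈ stdSimplex ℝ ι)
    (hne : θ ≠ Pi.single k 1) : ∑ i, c i * θ i < c k := by
  obtain ⟨h0, h1⟩ := hθ
  have hle : ∀ i, c i * θ i ≤ c k * θ i := fun i => by
    rcases eq_or_ne i k with rfl | hi
    · exact le_rfl
    · exact mul_le_mul_of_nonneg_right (hc i hi).le (h0 i)
  obtain ⟨j, hjk, hj⟩ : ∃ j, j ≠ k ∧ θ j ≠ 0 := by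
    by_contra! h
    refine hne (funext fun i => ?_)
    rcases eq_or_ne i k with rfl | hi
    · rw [Pi.single_eq_same, ← h1]
      exact (Finset.sum_eq_single i (fun b _ hb => h b hb) (by simp)).symm
    · rw [Pi.single_eq_of_ne hi, h i hi]
  calc ∑ i, c i * θ i < ∑ i, c k * θ i :=
        Finset.sum_lt_sum (fun i _ => hle i) ⟨j, Finset.mem_univ j,
          mul_lt_mul_of_pos_right (hc j hjk) ((h0 j).lt_of_ne' hj)⟩
    _ = c k := by rw [← Finset.mul_sum, h1, mul_one]

/-- The principal's objective for diagonal matrices, written as a sum over coordinates. -/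
theorem one_dotProduct_diagonal_mulVec {ι : Type*} [Fintype ι] [DecidableEq ι]
    (w o l θ : ι → ℝ) (s : ℝ) :
    (fun _ : ι => (1 : ℝ)) ⬝ᵥ
      ((diagonal l * ((1 : Matrix ι ι ℝ) + s • (diagonal o).transpose) *
        (diagonal w).transpose).mulVec θ) = ∑ i, l i * (1 + s * o i) * w i * θ i := by
  rw [diagonal_transpose, diagonal_transpose, ← diagonal_one, ← diagonal_smul, diagonal_add,
    diagonal_mul_diagonal, diagonal_mul_diagonal]
  simp [dotProduct, mulVec_diagonal]

/-- For every positive integer `n` there exist `n × n` diagonal matrices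
`W, Ω, Λ` with strictly positive diagonal entries and a horizon `T` such that for every
`k ∈ {1, …, n}` there is a round `t ∈ {1, …, T}` at which the `k`-th standard basis vector is
the unique maximizer over the probability simplex of
`θ ↦ 1ᵀ Λ (I + (t−1) Ωᵀ) Wᵀ θ`; hence the principal's optimal assessment policy can contain
`n` distinct assessment rules. -/
theorem optimal_policy_can_contain_n_distinct_rules
    (n : ℕ) (hn : 0 < n) :
    ∃ (W Ω Λ : Matrix (Fin n) (Fin n) ℝ) (T : ℕ),
      (∀ i j, i ≠ j → W i j = 0) ∧ (∀ i, 0 < W i i) ∧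
      (∀ i j, i ≠ j → Ω i j = 0) ∧ (∀ i, 0 < Ω i i) ∧
      (∀ i j, i ≠ j → Λ i j = 0) ∧ (∀ i, 0 < Λ i i) ∧
      0 < T ∧
      ∀ k : Fin n, ∃ t ∈ Finset.Icc 1 T,
        (Pi.single k (1 : ℝ) : Fin n → ℝ) ∈ stdSimplex ℝ (Fin n) ∧
        ∀ θ ∈ stdSimplex ℝ (Fin n), θ ≠ (Pi.single k (1 : ℝ) : Fin n → ℝ) →
          (fun _ : Fin n => (1 : ℝ)) ⬝ᵥ
            ((Λ * ((1 : Matrix (Fin n) (Fin n) ℝ) + ((t : ℝ) - 1) • Ω.transpose) *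
              W.transpose).mulVec θ) <
          (fun _ : Fin n => (1 : ℝ)) ⬝ᵥ
            ((Λ * ((1 : Matrix (Fin n) (Fin n) ℝ) + ((t : ℝ) - 1) • Ω.transpose) *
              W.transpose).mulVec (Pi.single k (1 : ℝ))) := by
  set a : Fin n → ℝ := fun i => (n : ℝ) ^ 2 + 1 - (i : ℝ) ^ 2 with ha
  have hapos : ∀ i, 0 < a i := fun i => by
    have h : (i : ℝ) ≤ n := by exact_mod_cast i.is_lt.le
    have h' : (0 : ℝ) ≤ i := Nat.cast_nonneg _
    simp only [ha]
    nlinarith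
  refine ⟨diagonal a, diagonal fun i => (2 * (i : ℝ) + 1) / a i, diagonal fun _ => 1, n,
    fun i j h => diagonal_apply_ne _ h, fun i => ?_, fun i j h => diagonal_apply_ne _ h,
    fun i => ?_, fun i j h => diagonal_apply_ne _ h, fun i => ?_, hn, fun k => ?_⟩
  · simpa using hapos i
  · rw [diagonal_apply_eq]
    exact div_pos (by positivity) (hapos i)
  · simp
  refine ⟨k + 1, Finset.mem_Icc.2 ⟨by omega, k.is_lt⟩, single_mem_stdSimplex ℝ k,
    fun θ hθ hne => ?_⟩
  rw [one_dotProduct_diagonal_mulVec, one_dotProduct_diagonal_mulVec]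
  -- The coefficients are, up to a common shift, tangent lines of `s ↦ s ^ 2` evaluated at `s = k`.
  have hcoef : ∀ i : Fin n, 1 * (1 + (((k + 1 : ℕ) : ℝ) - 1) * ((2 * (i : ℝ) + 1) / a i)) * a i =
      (n : ℝ) ^ 2 + 1 + k + (k : ℝ) ^ 2 - ((i : ℝ) - k) ^ 2 := fun i => by
    have hne := (hapos i).ne'
    field_simp
    simp only [ha]
    push_cast
    ring
  simp only [hcoef]
  refine (sum_mul_lt_of_mem_stdSimplex_of_ne_single (fun i hi => ?_) hθ hne).trans_eq ?_
  · have hik : ((i : ℕ) : ℝ) - k ≠ 0 :=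
      sub_ne_zero.2 fun h => hi (Fin.ext (by exact_mod_cast h))
    have := pow_pos (abs_pos.2 hik) 2
    rw [sq_abs] at this
    simpa using this
  · simp [Pi.single_apply]
end
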